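/- arXiv:math/0509089 — 2 statements merged into one kernel-verified Lean document; each statement's English description precedes it below -/
import Mathlib

section
/- Let k be a finite field of characteristic p ≥ 5 and let n ≥ 2. Then H^0(GL(n,k), S²(gl_n)) is 2-dimensional over k and H^1(GL(n,k), S²(gl_n)) = 0, where S²(gl_n) denotes the second symmetric power of the adjoint representation gl_n. -/
open scoped MatrixGroups TensorProduct

noncomputable section

/-- The adjoint (conjugation) representation of `GL(n,k)` on `gl_n`. -/
def glConj (k : Type) [Field k] (n : ℕ) :
    Representation k (GL (Fin n) k) (Matrix (Fin n) (Fin n) k) where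
  toFun g :=
    { toFun := fun x => (g : Matrix (Fin n) (Fin n) k) * x * (↑g⁻¹ : Matrix (Fin n) (Fin n) k)
      map_add' := fun x y => by noncomm_ring
      map_smul' := fun c x => by simp [Matrix.smul_mul, Matrix.mul_smul] }
  map_one' := by ext x; simp
  map_mul' g h := by
    ext x
    simp [Matrix.mul_assoc]

variable (k : Type) [Field k] {G : Type} [Group G]
variable (V : Type) [AddCommGroup V] [Module k V]

/-- The `m`-th tensor power of a representation (diagonal action). -/
def tpowRep (m : ℕ) (ρ : Representation k G V) :
    Representation k G (⨂[k] (_ : Fin m), V) :=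
  PiTensorProduct.mapMonoidHom.comp (Pi.monoidHom fun _ => ρ)

lemma tpowRep_apply (m : ℕ) (ρ : Representation k G V) (g : G) (f : Fin m → V) :
    tpowRep k V m ρ g (PiTensorProduct.tprod k f)
      = PiTensorProduct.tprod k (fun i => ρ g (f i)) := by
  exact PiTensorProduct.map_tprod (fun _ => ρ g) f

/-- The subspace of the `m`-th tensor power by which one quotients to obtain
the `m`-th symmetric power. -/
def symPowSub (m : ℕ) : Submodule k (⨂[k] (_ : Fin m), V) :=
  Submodule.span k {z | ∃ (σ : Equiv.Perm (Fin m)) (f : Fin m → V),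
    z = PiTensorProduct.tprod k f - PiTensorProduct.tprod k (f ∘ σ)}

/-- The `m`-th symmetric power of a `k`-vector space. -/
abbrev SymPow (m : ℕ) := (⨂[k] (_ : Fin m), V) ⧸ symPowSub k V m

/-- The `m`-th symmetric power of a representation. -/
def symPowRep (m : ℕ) (ρ : Representation k G V) :
    Representation k G (SymPow k V m) where
  toFun g := Submodule.mapQ _ _ (tpowRep k V m ρ g) (by
    rw [symPowSub, Submodule.span_le]
    rintro z ⟨σ, f, rfl⟩
    simp only [SetLike.mem_coe, Submodule.mem_comap, map_sub, tpowRep_apply]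
    refine Submodule.subset_span ⟨σ, fun i => ρ g (f i), ?_⟩
    simp [Function.comp_def])
  map_one' := by
    refine Submodule.linearMap_qext _ ?_
    refine PiTensorProduct.ext ?_
    ext f
    simp [Submodule.mapQ_apply, tpowRep_apply]
  map_mul' g h := by
    refine Submodule.linearMap_qext _ ?_
    refine PiTensorProduct.ext ?_
    ext f
    simp [Submodule.mapQ_apply, tpowRep_apply]

/-- The subspace of the `m`-th tensor power by which one quotients to obtain
the `m`-th exterior power: the span of pure tensors with two equal entries. -/
def altPowSub (m : ℕ) : Submodule k (⨂[k] (_ : Fin m), V) :=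
  Submodule.span k {z | ∃ (f : Fin m → V) (i j : Fin m), i ≠ j ∧ f i = f j ∧
    z = PiTensorProduct.tprod k f}

/-- The `m`-th exterior power of a `k`-vector space. -/
abbrev AltPow (m : ℕ) := (⨂[k] (_ : Fin m), V) ⧸ altPowSub k V m

/-- The `m`-th exterior power of a representation. -/
def altPowRep (m : ℕ) (ρ : Representation k G V) :
    Representation k G (AltPow k V m) where
  toFun g := Submodule.mapQ _ _ (tpowRep k V m ρ g) (by
    rw [altPowSub, Submodule.span_le]
    rintro z ⟨f, i, j, hij, hfij, rfl⟩
    simp only [SetLike.mem_coe, Submodule.mem_comap, tpowRep_apply]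
    exact Submodule.subset_span ⟨fun i => ρ g (f i), i, j, hij, by simp only [hfij], rfl⟩)
  map_one' := by
    refine Submodule.linearMap_qext _ (PiTensorProduct.ext ?_)
    ext f
    simp [Submodule.mapQ_apply, tpowRep_apply]
  map_mul' g h := by
    refine Submodule.linearMap_qext _ (PiTensorProduct.ext ?_)
    ext f
    simp [Submodule.mapQ_apply, tpowRep_apply]

/-- The second divided power `Γ²V ⊆ V ⊗ V`: tensors invariant under the flip. -/
def gamma2 : Submodule k (V ⊗[k] V) :=
  LinearMap.eqLocus (TensorProduct.comm k V V).toLinearMap LinearMap.id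

lemma comm_comp_map (f : V →ₗ[k] V) :
    (TensorProduct.comm k V V).toLinearMap ∘ₗ TensorProduct.map f f
      = TensorProduct.map f f ∘ₗ (TensorProduct.comm k V V).toLinearMap :=
  TensorProduct.ext' fun x y => by simp

lemma gamma2_stable (f : V →ₗ[k] V) :
    ∀ z ∈ gamma2 k V, TensorProduct.map f f z ∈ gamma2 k V := by
  intro z hz
  have h1 : (TensorProduct.comm k V V).toLinearMap z = z := hz
  have h2 := congrArg (fun φ => φ z) (comm_comp_map k V f)
  simp only [LinearMap.comp_apply] at h2
  rw [h1] at h2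
  exact h2

/-- The second divided power of a representation. -/
def gamma2Rep (ρ : Representation k G V) : Representation k G (gamma2 k V) where
  toFun g := ((ρ.tprod ρ) g).restrict (p := gamma2 k V) (q := gamma2 k V)
    (gamma2_stable k V (ρ g))
  map_one' := by
    ext z
    simp [LinearMap.restrict_apply, Representation.tprod_apply]
  map_mul' g h := by
    ext z
    simp only [LinearMap.restrict_apply, Representation.tprod_apply, map_mul,
      Module.End.mul_apply, LinearMap.coe_mk, AddHom.coe_mk, Submodule.coe_subtype]


namespace GLSym

open Matrix Kronecker

section basics
variable {K : Type} [Field K] {n : ℕ}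

abbrev CC (K : Type) (n : ℕ) := Matrix (Fin n × Fin n) (Fin n × Fin n) K

def kr (g : GL (Fin n) K) : CC K n := (g : Matrix (Fin n) (Fin n) K) ⊗ₖ (g : Matrix (Fin n) (Fin n) K)

lemma kr_one : kr (1 : GL (Fin n) K) = 1 := by simp [kr]

lemma kr_mul (g h : GL (Fin n) K) : kr (g * h) = kr g * kr h := by
  simp [kr, Matrix.mul_kronecker_mul]

def act : Representation K (GL (Fin n) K) (CC K n) where
  toFun g :=
    { toFun := fun F => kr g * F * kr g⁻¹
      map_add' := fun x y => by noncomm_ring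
      map_smul' := fun c x => by simp [Matrix.smul_mul, Matrix.mul_smul] }
  map_one' := by ext1 x; simp [kr_one]
  map_mul' g h := by
    ext1 x
    simp [kr_mul, Matrix.mul_assoc]

lemma act_def (g : GL (Fin n) K) (F : CC K n) : act g F = kr g * F * kr g⁻¹ := rfl

lemma act_mul_apply (g h : GL (Fin n) K) (F : CC K n) : act (g * h) F = act g (act h F) := by
  rw [map_mul]; rfl

/-- torus -/
def dg : (Fin n → Kˣ) →* GL (Fin n) K :=
  MonoidHom.toHomUnits
    { toFun := fun t => Matrix.diagonal (fun i => (t i : K))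
      map_one' := by simp
      map_mul' := fun s t => by simp [Matrix.diagonal_mul_diagonal] }

lemma dg_coe (t : Fin n → Kˣ) : ((dg t : GL (Fin n) K) : Matrix (Fin n) (Fin n) K) =
    Matrix.diagonal (fun i => (t i : K)) := rfl

/-- permutations -/
def pm : Equiv.Perm (Fin n) →* GL (Fin n) K :=
  MonoidHom.toHomUnits
    { toFun := fun σ => Matrix.of fun (i j : Fin n) => if i = σ j then (1:K) else 0
      map_one' := by ext i j; simp only [Matrix.one_apply, Matrix.of_apply, Equiv.Perm.coe_one, id_eq]; congr
      map_mul' := fun s t => by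
        ext i j; simp [Matrix.mul_apply]; congr }

lemma pm_coe (s : Equiv.Perm (Fin n)) : ((pm s : GL (Fin n) K) : Matrix (Fin n) (Fin n) K) =
    Matrix.of fun (i j : Fin n) => if i = s j then (1:K) else 0 := rfl

def tv {i j : Fin n} (h : i ≠ j) (c : K) : GL (Fin n) K where
  val := transvection i j c
  inv := transvection i j (-c)
  val_inv := by rw [transvection_mul_transvection_same _ _ h]; simp
  inv_val := by rw [transvection_mul_transvection_same _ _ h]; simp

lemma tv_coe {i j : Fin n} (h : i ≠ j) (c : K) :
  ((tv h c : GL (Fin n) K) : Matrix (Fin n) (Fin n) K) = transvection i j c := rfl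

lemma tv_mul {i j : Fin n} (h : i ≠ j) (c d : K) : tv h c * tv h d = tv h (c + d) := by
  apply Units.ext
  simp [tv_coe, transvection_mul_transvection_same _ _ h]

lemma tv_zero {i j : Fin n} (h : i ≠ j) : tv h (0 : K) = 1 := by
  apply Units.ext
  simp [tv_coe]

lemma tv_inv {i j : Fin n} (h : i ≠ j) (c : K) : (tv h c)⁻¹ = tv h (-c) := by
  rw [inv_eq_iff_mul_eq_one, tv_mul, add_neg_cancel, tv_zero]

lemma dg_tv {i j : Fin n} (h : i ≠ j) (c : K) (t : Fin n → Kˣ) :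
    dg t * tv h c * (dg t)⁻¹ = tv h (t i * c * ((t j)⁻¹ : Kˣ)) := by
  rw [mul_inv_eq_iff_eq_mul]
  apply Units.ext
  simp only [Units.val_mul, dg_coe, tv_coe, transvection]
  ext a b
  simp only [Matrix.diagonal_mul, Matrix.mul_diagonal, Matrix.add_apply, Matrix.one_apply, Matrix.single_apply]
  by_cases h1 : a = b
  · subst h1
    by_cases h2 : i = a ∧ j = a
    · exact absurd (h2.1.trans h2.2.symm) h
    · simp [h2]
  · by_cases h2 : i = a ∧ j = b
    · obtain ⟨rfl, rfl⟩ := h2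
      simp [h1]
    · simp [h1, h2]

lemma pm_tv {i j : Fin n} (h : i ≠ j) (c : K) (s : Equiv.Perm (Fin n)) :
    pm s * tv h c * (pm s)⁻¹ = tv (s.injective.ne h) c := by
  rw [mul_inv_eq_iff_eq_mul]
  apply Units.ext
  simp only [Units.val_mul, pm_coe, tv_coe, transvection]
  ext a b
  simp only [Matrix.mul_apply, Matrix.add_apply, Matrix.one_apply, Matrix.single_apply, Matrix.of_apply,
    mul_add, add_mul, Finset.sum_add_distrib]
  congr 1
  · simp
  · by_cases h1 : s i = a
    · by_cases h2 : j = b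
      · subst h1 h2; simp
      · simp only [h1, h2, and_false, if_false, mul_zero, Finset.sum_const_zero, true_and]
        symm; apply Finset.sum_eq_zero; intro x _
        by_cases h3 : s j = x
        · subst h3; simp [h2]
        · simp [h3]
    · simp only [h1, false_and, if_false, zero_mul, Finset.sum_const_zero]
      apply Finset.sum_eq_zero; intro x _
      by_cases h3 : i = x
      · subst h3; simp [Ne.symm h1]
      · simp [h3]

lemma act_dg (t : Fin n → Kˣ) (F : CC K n) (a b c d : Fin n) :
    act (dg t) F (a, c) (b, d) = (t a * t c : K) * F (a, c) (b, d) * ((t b)⁻¹ * (t d)⁻¹ : Kˣ) := by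
  rw [act_def, ← map_inv]
  simp only [kr, dg_coe, Matrix.diagonal_kronecker_diagonal, Matrix.mul_diagonal, Matrix.diagonal_mul]
  simp

lemma act_pm (s : Equiv.Perm (Fin n)) (F : CC K n) (a b c d : Fin n) :
    act (pm s) F (s a, s c) (s b, s d) = F (a, c) (b, d) := by
  rw [act_def, ← map_inv]
  simp only [kr, pm_coe, Matrix.mul_apply, Matrix.kroneckerMap_apply, Matrix.of_apply,
    Fintype.sum_prod_type]
  have h : ∀ x y : Fin n, x = s⁻¹ y ↔ y = s x := fun x y => by
    rw [Equiv.Perm.eq_inv_iff_eq, eq_comm]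
  simp [h, Finset.sum_ite_eq, ite_and]

lemma act_tv {i j : Fin n} (h : i ≠ j) (x : K) (F : CC K n) (a b c d : Fin n) :
    act (tv h x) F (a, c) (b, d) =
     (F (a, c) (b, d) + (if a = i then x else 0) * F (j, c) (b, d)
       + (if c = i then x else 0) * F (a, j) (b, d)
       + (if a = i then x else 0) * (if c = i then x else 0) * F (j, j) (b, d))
     - (if b = j then x else 0) * 
      (F (a, c) (i, d) + (if a = i then x else 0) * F (j, c) (i, d)
       + (if c = i then x else 0) * F (a, j) (i, d)
       + (if a = i then x else 0) * (if c = i then x else 0) * F (j, j) (i, d))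
     - (if d = j then x else 0) *
      (F (a, c) (b, i) + (if a = i then x else 0) * F (j, c) (b, i)
       + (if c = i then x else 0) * F (a, j) (b, i)
       + (if a = i then x else 0) * (if c = i then x else 0) * F (j, j) (b, i))
     + (if b = j then x else 0) * (if d = j then x else 0) *
      (F (a, c) (i, i) + (if a = i then x else 0) * F (j, c) (i, i)
       + (if c = i then x else 0) * F (a, j) (i, i)
       + (if a = i then x else 0) * (if c = i then x else 0) * F (j, j) (i, i)) := by
  rw [act_def, tv_inv]
  simp only [kr, tv_coe]
  have L : ∀ (G : CC K n) (a c : Fin n) (q), ((transvection i j x ⊗ₖ transvection i j x) * G) (a, c) q =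
     G (a, c) q + (if a = i then x else 0) * G (j, c) q
       + (if c = i then x else 0) * G (a, j) q
       + (if a = i then x else 0) * (if c = i then x else 0) * G (j, j) q := by
    intro G a c q
    simp only [Matrix.mul_apply, Matrix.kroneckerMap_apply, Fintype.sum_prod_type, transvection,
      Matrix.add_apply, Matrix.one_apply, Matrix.single_apply, eq_comm (a := i), ite_and]
    simp only [add_mul, mul_add, Finset.sum_add_distrib]
    by_cases h1 : a = i <;> by_cases h2 : c = i <;>
    simp [h1, h2, ite_mul, mul_ite, Finset.sum_ite_eq, Finset.sum_add_distrib, eq_comm (a := j)] <;> ring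
  have R : ∀ (G : CC K n) (p) (b d : Fin n), (G * (transvection i j (-x) ⊗ₖ transvection i j (-x))) p (b, d) =
     G p (b, d) - (if b = j then x else 0) * G p (i, d)
       - (if d = j then x else 0) * G p (b, i)
       + (if b = j then x else 0) * (if d = j then x else 0) * G p (i, i) := by
    intro G p b d
    simp only [Matrix.mul_apply, Matrix.kroneckerMap_apply, Fintype.sum_prod_type, transvection,
      Matrix.add_apply, Matrix.one_apply, Matrix.single_apply, eq_comm (a := j), ite_and]
    simp only [add_mul, mul_add, Finset.sum_add_distrib]
    by_cases h1 : b = j <;> by_cases h2 : d = j <;>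
    simp [h1, h2, ite_mul, mul_ite, Finset.sum_ite_eq, Finset.sum_add_distrib, eq_comm (a := i)] <;> ring
  rw [R, L, L, L, L]

end basics

section main
variable {K : Type} [Field K] {n : ℕ}

def IsC (f : GL (Fin n) K → CC K n) : Prop := ∀ g h, f (g * h) = f g + act g (f h)

lemma IsC.one {f : GL (Fin n) K → CC K n} (hf : IsC f) : f 1 = 0 := by
  have := hf 1 1
  simpa using this

lemma IsC.inv {f : GL (Fin n) K → CC K n} (hf : IsC f) {h : GL (Fin n) K} (hh : f h = 0) :
    f h⁻¹ = 0 := by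
  have h1 := hf h⁻¹ h
  rw [hh, inv_mul_cancel, hf.one] at h1
  simpa using h1.symm

lemma IsC.conj {f : GL (Fin n) K → CC K n} (hf : IsC f) {h : GL (Fin n) K} (hh : f h = 0)
    (g : GL (Fin n) K) : f (h * g * h⁻¹) = act h (f g) := by
  rw [hf, hf, hh, hf.inv hh]; simp

def wt (i a b c d : Fin n) : ℤ :=
  (if a = i then 1 else 0) + (if c = i then 1 else 0) - (if b = i then 1 else 0)
    - (if d = i then 1 else 0)

def upd (l : Fin n) (u : Kˣ) : Fin n → Kˣ := fun a => if a = l then u else 1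

lemma act_upd (l : Fin n) (u : Kˣ) (F : CC K n) (a b c d : Fin n) :
    act (dg (upd l u)) F (a, c) (b, d) = ((u ^ (wt l a b c d) : Kˣ) : K) * F (a, c) (b, d) := by
  rw [act_dg]
  have : (u ^ (wt l a b c d) : Kˣ) = upd l u a * upd l u c * ((upd l u b)⁻¹ * (upd l u d)⁻¹) := by
    simp only [wt, upd, _root_.zpow_sub, _root_.zpow_add]
    split_ifs <;> simp [mul_assoc, sq]
  rw [this]
  push_cast
  ring

lemma lead {i j : Fin n} (h : i ≠ j) (x : K) {X : CC K n} {m : ℤ}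
    (hX : ∀ a b c d, wt i a b c d < m → X (a, c) (b, d) = 0) (a b c d : Fin n)
    (hq : wt i a b c d ≤ m) : act (tv h x) X (a, c) (b, d) = X (a, c) (b, d) := by
  have key : ∀ a' b' c' d', wt i a' b' c' d' < wt i a b c d → X (a', c') (b', d') = 0 :=
    fun a' b' c' d' h' => hX _ _ _ _ (lt_of_lt_of_le h' hq)
  rw [act_tv]
  have s1 : (if a = i then x else 0) * X (j, c) (b, d) = 0 := by
    split_ifs <;> first | (simp; done) | (rw [key j b c d (by unfold wt; grind)]; simp)
  have s2 : (if c = i then x else 0) * X (a, j) (b, d) = 0 := by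
    split_ifs <;> first | (simp; done) | (rw [key a b j d (by unfold wt; grind)]; simp)
  have s3 : (if a = i then x else 0) * (if c = i then x else 0) * X (j, j) (b, d) = 0 := by
    split_ifs <;> first | (simp; done) | (rw [key j b j d (by unfold wt; grind)]; simp)
  have s4 : (if b = j then x else 0) * X (a, c) (i, d) = 0 := by
    split_ifs <;> first | (simp; done) | (rw [key a i c d (by unfold wt; grind)]; simp)
  have s5 : (if a = i then x else 0) * (if b = j then x else 0) * X (j, c) (i, d) = 0 := by
    split_ifs <;> first | (simp; done) | (rw [key j i c d (by unfold wt; grind)]; simp)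
  have s6 : (if c = i then x else 0) * (if b = j then x else 0) * X (a, j) (i, d) = 0 := by
    split_ifs <;> first | (simp; done) | (rw [key a i j d (by unfold wt; grind)]; simp)
  have s7 : (if a = i then x else 0) * (if c = i then x else 0) * (if b = j then x else 0) * X (j, j) (i, d) = 0 := by
    split_ifs <;> first | (simp; done) | (rw [key j i j d (by unfold wt; grind)]; simp)
  have s8 : (if d = j then x else 0) * X (a, c) (b, i) = 0 := by
    split_ifs <;> first | (simp; done) | (rw [key a b c i (by unfold wt; grind)]; simp)
  have s9 : (if a = i then x else 0) * (if d = j then x else 0) * X (j, c) (b, i) = 0 := by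
    split_ifs <;> first | (simp; done) | (rw [key j b c i (by unfold wt; grind)]; simp)
  have s10 : (if c = i then x else 0) * (if d = j then x else 0) * X (a, j) (b, i) = 0 := by
    split_ifs <;> first | (simp; done) | (rw [key a b j i (by unfold wt; grind)]; simp)
  have s11 : (if a = i then x else 0) * (if c = i then x else 0) * (if d = j then x else 0) * X (j, j) (b, i) = 0 := by
    split_ifs <;> first | (simp; done) | (rw [key j b j i (by unfold wt; grind)]; simp)
  have s12 : (if b = j then x else 0) * (if d = j then x else 0) * X (a, c) (i, i) = 0 := by
    split_ifs <;> first | (simp; done) | (rw [key a i c i (by unfold wt; grind)]; simp)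
  have s13 : (if a = i then x else 0) * (if b = j then x else 0) * (if d = j then x else 0) * X (j, c) (i, i) = 0 := by
    split_ifs <;> first | (simp; done) | (rw [key j i c i (by unfold wt; grind)]; simp)
  have s14 : (if c = i then x else 0) * (if b = j then x else 0) * (if d = j then x else 0) * X (a, j) (i, i) = 0 := by
    split_ifs <;> first | (simp; done) | (rw [key a i j i (by unfold wt; grind)]; simp)
  have s15 : (if a = i then x else 0) * (if c = i then x else 0) * (if b = j then x else 0) * (if d = j then x else 0) * X (j, j) (i, i) = 0 := by
    split_ifs <;> first | (simp; done) | (rw [key j i j i (by unfold wt; grind)]; simp)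
  linear_combination s1 + s2 + s3 - s4 - s5 - s6 - s7 - s8 - s9 - s10 - s11 + s12 + s13 + s14 + s15

end main

section coc
variable {K : Type} [Field K] {n : ℕ}

structure Good (f : GL (Fin n) K → CC K n) : Prop where
  c : IsC f
  T : ∀ t, f (dg t) = 0
  W : ∀ s, f (pm s) = 0
  S : ∀ g a b c d, f g (a, c) (b, d) = f g (c, a) (d, b)

variable {f : GL (Fin n) K → CC K n}

lemma Good.eqv (hf : Good f) {i j : Fin n} (h : i ≠ j) {i' j' : Fin n} (h' : i' ≠ j')
    (s : Equiv.Perm (Fin n)) (hi : s i = i') (hj : s j = j') (x : K) (a b c d : Fin n) :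
    f (tv h' x) (s a, s c) (s b, s d) = f (tv h x) (a, c) (b, d) := by
  subst hi hj
  rw [← pm_tv h, hf.c.conj (hf.W s), act_pm]

lemma Good.scale (hf : Good f) {i j : Fin n} (h : i ≠ j) (x : K) (u : Kˣ) :
    f (tv h (u * x)) = act (dg (upd i u)) (f (tv h x)) := by
  rw [← hf.c.conj (hf.T _), dg_tv]
  simp [upd, h.symm]

lemma Good.fix (hf : Good f) {i j : Fin n} (h : i ≠ j) (x : K) (u : Kˣ) (l : Fin n)
    (hi : l ≠ i) (hj : l ≠ j) :
    f (tv h x) = act (dg (upd l u)) (f (tv h x)) := by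
  rw [← hf.c.conj (hf.T _), dg_tv]
  simp [upd, hi.symm, hj.symm]

lemma zpow_ne (h2 : (2 : K) ≠ 0) (h3 : (3 : K) ≠ 0) (w : ℤ) (hw : w ≠ 0) (h1 : -2 ≤ w)
    (h1' : w ≤ 2) : (2 : K) ^ w ≠ 1 := by
  intro h
  have : w = -2 ∨ w = -1 ∨ w = 1 ∨ w = 2 := by omega
  have e2 : (2:K)⁻¹ * 2 = 1 := inv_mul_cancel₀ h2
  rcases this with rfl | rfl | rfl | rfl
  · have h' : ((2:K)^2)⁻¹ = 1 := by simpa [_root_.zpow_neg] using h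
    rw [inv_eq_one] at h'
    apply h3; linear_combination h'
  · have h' : (2:K)⁻¹ = 1 := by simpa using h
    rw [inv_eq_one] at h'
    apply one_ne_zero (α := K); linear_combination h'
  · have h' : (2:K) = 1 := by simpa using h
    apply one_ne_zero (α := K); linear_combination h'
  · have h' : (2:K)^2 = 1 := by exact_mod_cast h
    apply h3; linear_combination h'

lemma wt_bd (i a b c d : Fin n) : -2 ≤ wt i a b c d ∧ wt i a b c d ≤ 2 := by
  unfold wt; split_ifs <;> simp

lemma van_gen (h2 : (2 : K) ≠ 0) (h3 : (3 : K) ≠ 0) {X : CC K n} (l : Fin n)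
    (hX : X = act (dg (upd l (Units.mk0 2 h2))) X) (a b c d : Fin n) (hw : wt l a b c d ≠ 0) :
    X (a, c) (b, d) = 0 := by
  have h1 := congrFun (congrFun hX (a, c)) (b, d)
  rw [act_upd] at h1
  have h4 := zpow_ne h2 h3 _ hw (wt_bd _ _ _ _ _).1 (wt_bd _ _ _ _ _).2
  simp only [Units.val_zpow_eq_zpow_val, Units.val_mk0] at h1
  have : ((2:K) ^ (wt l a b c d) - 1) * X (a, c) (b, d) = 0 := by linear_combination -h1
  exact (mul_eq_zero.1 this).resolve_left (sub_ne_zero.2 h4)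

lemma Good.van (hf : Good f) (h2 : (2 : K) ≠ 0) (h3 : (3 : K) ≠ 0) {i j : Fin n} (h : i ≠ j) (x : K)
    (l : Fin n) (hi : l ≠ i) (hj : l ≠ j) (a b c d : Fin n) (hw : wt l a b c d ≠ 0) :
    f (tv h x) (a, c) (b, d) = 0 :=
  van_gen h2 h3 l (hf.fix h x _ l hi hj) a b c d hw

lemma Good.two (hf : Good f) {i j : Fin n} (h : i ≠ j) :
    f (tv h 2) = f (tv h 1) + act (tv h 1) (f (tv h 1)) := by
  rw [← hf.c, tv_mul]; norm_num

lemma Good.three (hf : Good f) {i j : Fin n} (h : i ≠ j) :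
    f (tv h 3) = f (tv h 1) + act (tv h 1) (f (tv h 1) + act (tv h 1) (f (tv h 1))) := by
  rw [← hf.two, ← hf.c, tv_mul]; norm_num

lemma Good.two_apply (hf : Good f) (h2 : (2 : K) ≠ 0) {i j : Fin n} (h : i ≠ j) (a b c d) :
    (2 : K) ^ (wt i a b c d) * f (tv h 1) (a, c) (b, d) =
      f (tv h 1) (a, c) (b, d) + act (tv h 1) (f (tv h 1)) (a, c) (b, d) := by
  have h1 := hf.scale h 1 (Units.mk0 2 h2)
  rw [Units.val_mk0, mul_one, hf.two] at h1
  have h4 := congrFun (congrFun h1 (a, c)) (b, d)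
  rw [act_upd] at h4
  simpa using h4.symm

lemma Good.three_apply (hf : Good f) (h3 : (3 : K) ≠ 0) {i j : Fin n} (h : i ≠ j) (a b c d) :
    (3 : K) ^ (wt i a b c d) * f (tv h 1) (a, c) (b, d) =
      f (tv h 1) (a, c) (b, d) + (act (tv h 1) (f (tv h 1)) (a, c) (b, d) + 
        act (tv h 1) (act (tv h 1) (f (tv h 1))) (a, c) (b, d)) := by
  have h1 := hf.scale h 1 (Units.mk0 3 h3)
  rw [Units.val_mk0, mul_one, hf.three] at h1
  have h4 := congrFun (congrFun h1 (a, c)) (b, d)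
  rw [act_upd] at h4
  simpa using h4.symm

lemma Good.step (hf : Good f) (h2 : (2 : K) ≠ 0) (h3 : (3 : K) ≠ 0) {i j : Fin n} (h : i ≠ j)
    {m : ℤ} (hm : m ≠ 1)
    (hX : ∀ a b c d, wt i a b c d < m → f (tv h 1) (a, c) (b, d) = 0) :
    ∀ a b c d, wt i a b c d < m + 1 → f (tv h 1) (a, c) (b, d) = 0 := by
  intro a b c d hw
  rcases lt_or_eq_of_le (Int.lt_add_one_iff.1 hw) with hw | hw
  · exact hX _ _ _ _ hw
  have e1 := hf.two_apply h2 h a b c d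
  have e2 := hf.three_apply h3 h a b c d
  have l1 := lead h (1 : K) hX
  have l2 := lead h (1 : K) (X := act (tv h 1) (f (tv h 1))) (m := m) (fun a b c d hq => by
    rw [l1 a b c d hq.le, hX _ _ _ _ hq])
  rw [l1 _ _ _ _ hw.le] at e1
  rw [l2 _ _ _ _ hw.le, l1 _ _ _ _ hw.le] at e2
  have hb := wt_bd i a b c d
  rw [hw] at e1 e2 hb
  generalize f (tv h 1) (a, c) (b, d) = y at e1 e2
  have : m = -2 ∨ m = -1 ∨ m = 0 ∨ m = 2 := by omega
  rcases this with rfl | rfl | rfl | rfl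
  · have e3 : (2:K) ^ 2 * (2 : K) ^ (-2 : ℤ) = 1 := by
      rw [_root_.zpow_neg]; exact_mod_cast mul_inv_cancel₀ (pow_ne_zero 2 h2)
    have e4 : (3:K) ^ 2 * (3 : K) ^ (-2 : ℤ) = 1 := by
      rw [_root_.zpow_neg]; exact_mod_cast mul_inv_cancel₀ (pow_ne_zero 2 h3)
    linear_combination (11 * 4) * e1 - (3 * 9) * e2 - 11 * y * e3 + 3 * y * e4
  · have e3 : (2:K) * (2 : K) ^ (-1 : ℤ) = 1 := by
      rw [_root_.zpow_neg]; simp [h2]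
    have : 3 * y = 0 := by linear_combination -2 * e1 + y * e3
    exact (mul_eq_zero.1 this).resolve_left h3
  · simp only [zpow_zero] at e1
    linear_combination -e1
  · have e1' : (2:K)^2 * y = y + y := by exact_mod_cast e1
    have : 2 * y = 0 := by linear_combination e1'
    exact (mul_eq_zero.1 this).resolve_left h2

lemma Good.low (hf : Good f) (h2 : (2 : K) ≠ 0) (h3 : (3 : K) ≠ 0) {i j : Fin n} (h : i ≠ j) :
    ∀ a b c d, wt i a b c d < 1 → f (tv h 1) (a, c) (b, d) = 0 := by
  have h0 : ∀ a b c d, wt i a b c d < -2 → f (tv h 1) (a, c) (b, d) = 0 := by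
    intro a b c d hw
    have := (wt_bd i a b c d).1
    omega
  exact hf.step h2 h3 h (by norm_num) (hf.step h2 h3 h (by norm_num) (hf.step h2 h3 h (by norm_num) h0))

lemma weyl_rel {i j : Fin n} (h : i ≠ j) :
    tv h (1 : K) * tv h.symm (-1) = pm (Equiv.swap i j) * dg (upd i (-1)) * tv h (-1) := by
  have : tv h (1 : K) * tv h.symm (-1) * tv h 1 = pm (Equiv.swap i j) * dg (upd i (-1)) := by
    apply Units.ext
    simp only [Units.val_mul, pm_coe, tv_coe, dg_coe, transvection]
    simp only [mul_add, add_mul, mul_one, one_mul, Matrix.single_mul_single_same, 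
      Matrix.single_mul_single_of_ne _ _ _ _ h, Matrix.single_mul_single_of_ne _ _ _ _ h.symm]
    ext a b
    simp only [Matrix.mul_diagonal, Matrix.add_apply, Matrix.one_apply, Matrix.single_apply, Matrix.of_apply, upd, Equiv.swap_apply_def]
    have h' := h.symm
    simp only [Matrix.zero_apply, eq_comm (a := i), eq_comm (a := j)]
    by_cases hbi : b = i
    · subst hbi
      by_cases haj : a = j
      · subst haj; simp [h, h']
      · by_cases hab : a = b
        · subst hab; simp [h, h']
        · simp [haj, hab, h, h']
    · by_cases hbj : b = j
      · subst hbj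
        by_cases hai : a = i
        · subst hai; simp [h, h']
        · by_cases hab : a = b
          · subst hab; simp [h, h']
          · simp [hai, hab, h, h']
      · simp [hbi, hbj, h, h']
  rw [← this, mul_assoc _ (tv h 1), tv_mul, add_neg_cancel, tv_zero, mul_one]

lemma Good.beta (hf : Good f) (h2 : (2 : K) ≠ 0) (h3 : (3 : K) ≠ 0) {i j : Fin n} (h : i ≠ j)
    (hα : ∀ (i j : Fin n) (h : i ≠ j), f (tv h 1) (i, i) (j, i) = 0) :
    f (tv h.symm 1) (j, i) (i, i) = 0 := by
  have h' := h.symm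
  have low := hf.low h2 h3 h
  have low' := hf.low h2 h3 h'
  have e1 := hf.two_apply h2 h' j i j i
  rw [act_tv] at e1
  have a1 := hα _ _ h'
  have a2 := hf.S (tv h' 1) j j j i
  have a3 := hf.S (tv h' 1) j i i i
  have hw : wt j j i j i = 2 := by simp [wt, h]
  rw [hw] at e1
  simp only [if_true] at e1
  rw [low' i j i j (by simp [wt, h]), low' i j i i (by simp [wt, h]), low' i i i j (by simp [wt, h]),
    low' i i i i (by simp [wt, h]), low' i j j i (by simp [wt, h]),
    low' j j i i (by simp [wt, h]), low' i i j j (by simp [wt, h]), low' j i i j (by simp [wt, h]),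
    low' i j j j (by simp [wt, h]), low' j j i j (by simp [wt, h]), low' j j j j (by simp [wt, h]),
    a2, a1, ← a3] at e1
  have e1' : (2:K) ^ 2 * f (tv h' 1) (j, j) (i, i) = 2 * f (tv h' 1) (j, j) (i, i) +
      2 * f (tv h' 1) (j, i) (i, i) := by
    rw [zpow_ofNat] at e1
    linear_combination e1
  have r := congrArg f (weyl_rel (K := K) h)
  have hm : f (pm (Equiv.swap i j) * dg (upd i (-1))) = 0 := by
    rw [hf.c, hf.W, hf.T]; simp
  rw [hf.c, hf.c, hm, zero_add] at r
  have s1 := hf.scale h 1 (-1)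
  have s2 := hf.scale h' 1 (-1)
  simp only [Units.val_neg, Units.val_one, mul_one] at s1 s2
  rw [s1, s2] at r
  have r2 := congrFun (congrFun r (i, i)) (i, i)
  rw [Matrix.add_apply, low i i i i (by simp [wt]), act_tv, act_mul_apply] at r2
  have r3 := act_pm (K := K) (Equiv.swap i j) (act (dg (upd i (-1))) (act (dg (upd i (-1))) (f (tv h 1)))) j j j j
  rw [Equiv.swap_apply_right] at r3
  rw [r3] at r2
  simp only [act_upd, h, h', if_true, if_false] at r2
  rw [low j j j j (by simp [wt]), low' i i i i (by simp [wt])] at r2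
  have w1 : wt j j i i i = 1 := by simp [wt, h]
  have w2 : wt j i i j i = 1 := by simp [wt, h]
  simp only [hw, w1, w2, ← a3] at r2
  simp at r2
  have : 2 * f (tv h' 1) (j, i) (i, i) = 0 := by
    linear_combination -2 * r2 + e1'
  exact (mul_eq_zero.1 this).resolve_left h2

end coc

section coc2
variable {K : Type} [Field K] {n : ℕ} {f : GL (Fin n) K → CC K n}

lemma steinberg {i j l : Fin n} (hij : i ≠ j) (hjl : j ≠ l) (hil : i ≠ l) :
    tv hij (1 : K) * tv hjl 1 = tv hil 1 * (tv hjl 1 * tv hij 1) := by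
  apply Units.ext
  simp only [Units.val_mul, tv_coe, transvection]
  simp only [mul_add, add_mul, mul_one, one_mul, Matrix.single_mul_single_same,
    Matrix.single_mul_single_of_ne _ _ _ _ hij.symm, Matrix.single_mul_single_of_ne _ _ _ _ hjl.symm,
    Matrix.single_mul_single_of_ne _ _ _ _ hil.symm, add_zero]
  abel

lemma Good.ge (hf : Good f) (h2 : (2 : K) ≠ 0) (h3 : (3 : K) ≠ 0) {i j l : Fin n} (hij : i ≠ j)
    (hjl : j ≠ l) (hil : i ≠ l)
    (hα : ∀ (i j : Fin n) (h : i ≠ j), f (tv h 1) (i, i) (j, i) = 0) :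
    f (tv hij 1) (i, l) (j, l) = 0 ∧ f (tv hij 1) (i, l) (l, j) = 0 := by
  have low1 := hf.low h2 h3 hij
  have low2 := hf.low h2 h3 hjl
  have low3 := hf.low h2 h3 hil
  have r := congrArg f (steinberg (K := K) hij hjl hil)
  rw [hf.c, hf.c, hf.c, map_add] at r
  have r1 := congrFun (congrFun r (i, i)) (l, i)
  have r2 := congrFun (congrFun r (i, j)) (l, j)
  simp only [Matrix.add_apply, act_tv, hij, hjl, hil, hij.symm, hjl.symm, hil.symm, if_true, if_false,
    zero_mul, mul_zero, add_zero, sub_zero, one_mul, zero_add, zero_sub] at r1 r2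
  have v1 := hf.van h2 h3 hij 1 l hil.symm hjl.symm
  have v2 := hf.van h2 h3 hjl 1 i hij hil
  have v3 := hf.van h2 h3 hil 1 j hij.symm hjl
  have b1 := hf.beta h2 h3 hij.symm hα
  have a1 := hα _ _ hij
  have a2 := hα _ _ hjl
  have a3 := hα _ _ hil
  simp (discharger := (simp [wt, hij, hjl, hil, hij.symm, hjl.symm, hil.symm])) only
    [low1, low2, low3, v1, v2, v3, b1, a1, a2, a3, add_zero, zero_add, sub_zero, zero_sub, neg_zero] at r1 r2
  have s1 : (Equiv.swap i j * Equiv.swap j l) i = j := by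
    rw [Equiv.Perm.mul_apply, Equiv.swap_apply_of_ne_of_ne hij hil, Equiv.swap_apply_left]
  have s2 : (Equiv.swap i j * Equiv.swap j l) j = l := by
    rw [Equiv.Perm.mul_apply, Equiv.swap_apply_left, Equiv.swap_apply_of_ne_of_ne hil.symm hjl.symm]
  have s3 : (Equiv.swap i j * Equiv.swap j l) l = i := by
    rw [Equiv.Perm.mul_apply, Equiv.swap_apply_right, Equiv.swap_apply_right]
  have t1 : Equiv.swap j l i = i := Equiv.swap_apply_of_ne_of_ne hij hil
  have t2 : Equiv.swap j l j = l := Equiv.swap_apply_left _ _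
  have t3 : Equiv.swap j l l = j := Equiv.swap_apply_right _ _
  have e1 := hf.eqv hij hjl _ s1 s2 1 i j l l
  have e2 := hf.eqv hij hjl _ s1 s2 1 i l l j
  have e3 := hf.eqv hij hil _ t1 t2 1 i j l l
  rw [s1, s2, s3] at e1 e2
  rw [t1, t2, t3] at e3
  have e4 := hf.S (tv hjl 1) j i i l
  rw [← e4, e1, e2] at r1
  rw [← e4, e2, e3] at r2
  constructor
  · linear_combination 2 * r1 + r2
  · linear_combination -r1 - r2

lemma Good.wt1 (hf : Good f) (h2 : (2 : K) ≠ 0) (h3 : (3 : K) ≠ 0) {i j : Fin n} (h : i ≠ j)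
    (hα : ∀ (i j : Fin n) (h : i ≠ j), f (tv h 1) (i, i) (j, i) = 0) (b c d : Fin n)
    (hw : wt i i b c d = 1) : f (tv h 1) (i, c) (b, d) = 0 := by
  have hv : ∀ l, l ≠ i → l ≠ j → wt l i b c d ≠ 0 → f (tv h 1) (i, c) (b, d) = 0 :=
    fun l hi hj => hf.van h2 h3 h 1 l hi hj i b c d
  have ge := fun l (hjl : j ≠ l) (hil : i ≠ l) => hf.ge h2 h3 h hjl hil hα
  have a1 := hα _ _ h
  have b1 := hf.beta h2 h3 h.symm hα
  have sy := hf.S (tv h 1) i b c d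
  have h' := h.symm
  by_cases hc : c = i
  · subst hc
    by_cases hb : b = c
    · subst hb
      by_cases hd : d = j
      · subst hd; rw [sy]; exact a1
      · have hd' : d ≠ b := by rintro rfl; simp [wt] at hw
        exact hv d hd' hd (by simp [wt, hd', hd'.symm])
    · by_cases hd : d = c
      · subst hd
        by_cases hbj : b = j
        · subst hbj; exact a1
        · exact hv b hb hbj (by simp [wt, hb, Ne.symm hb])
      · simp [wt, hb, hd] at hw
  · by_cases hb : b = i
    · subst hb
      simp [wt, hc] at hw
      split_ifs at hw
      omega
    · have hd : d ≠ i := by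
        rintro rfl; simp [wt, hb, hc] at hw
      by_cases hcj : c = j
      · subst hcj
        by_cases hbj : b = c
        · subst hbj
          by_cases hdj : d = b
          · subst hdj; exact b1
          · exact hv d hd hdj (by simp [wt, hdj, Ne.symm hdj, hd.symm])
        · refine hv b hb hbj ?_
          simp [wt, Ne.symm hb, Ne.symm hbj]; split_ifs <;> omega
      · by_cases hbc : b = c
        · subst hbc
          by_cases hdj : d = j
          · subst hdj; exact (ge b (Ne.symm hcj) (Ne.symm hb)).2
          · refine hv d hd hdj ?_
            simp [wt, hd.symm]
        · by_cases hdc : d = c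
          · subst hdc
            by_cases hbj : b = j
            · subst hbj; exact (ge d (Ne.symm hcj) (Ne.symm hd)).1
            · exact hv b hb hbj (by simp [wt, Ne.symm hb, Ne.symm hbc])
          · exact hv c hc hcj (by simp [wt, Ne.symm hc, hbc, hdc])

lemma Good.tv1 (hf : Good f) (h2 : (2 : K) ≠ 0) (h3 : (3 : K) ≠ 0) {i j : Fin n} (h : i ≠ j)
    (hα : ∀ (i j : Fin n) (h : i ≠ j), f (tv h 1) (i, i) (j, i) = 0) : f (tv h 1) = 0 := by
  have low := hf.low h2 h3 h
  have l2 : ∀ a b c d, wt i a b c d < 2 → f (tv h 1) (a, c) (b, d) = 0 := by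
    intro a b c d hw
    by_cases h1 : wt i a b c d < 1
    · exact low _ _ _ _ h1
    have h1 : wt i a b c d = 1 := by omega
    by_cases ha : a = i
    · subst ha
      exact hf.wt1 h2 h3 h hα _ _ _ h1
    · by_cases hc : c = i
      · subst hc
        rw [hf.S]
        refine hf.wt1 h2 h3 h hα _ _ _ ?_
        rw [← h1]; simp only [wt]; ring
      · simp [wt, ha, hc] at h1
        split_ifs at h1 <;> omega
  ext ⟨a, c⟩ ⟨b, d⟩
  exact hf.step h2 h3 h (by norm_num) l2 a b c d (by have := (wt_bd i a b c d).2; omega)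

lemma Good.zero (hf : Good f) (h2 : (2 : K) ≠ 0) (h3 : (3 : K) ≠ 0)
    (hα : ∀ (i j : Fin n) (h : i ≠ j), f (tv h 1) (i, i) (j, i) = 0) : f = 0 := by
  have htv : ∀ (i j : Fin n) (h : i ≠ j) (c : K), f (tv h c) = 0 := by
    intro i j h c
    by_cases hc : c = 0
    · subst hc; rw [tv_zero, hf.c.one]
    · have := hf.scale h 1 (Units.mk0 c hc)
      rw [hf.tv1 h2 h3 h hα] at this
      simpa using this
  have key : ∀ M : Matrix (Fin n) (Fin n) K, M.det ≠ 0 → ∀ g : GL (Fin n) K, g.val = M → f g = 0 := by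
    intro M hM
    refine Matrix.diagonal_transvection_induction_of_det_ne_zero
      (fun M => ∀ g : GL (Fin n) K, g.val = M → f g = 0) M hM ?_ ?_ ?_
    · intro D hD g hg
      rw [det_diagonal, Finset.prod_ne_zero_iff] at hD
      have : g = dg (fun i => Units.mk0 (D i) (hD i (Finset.mem_univ _))) := by
        apply Units.ext; rw [hg, dg_coe]; rfl
      rw [this, hf.T]
    · intro t g hg
      have : g = tv t.hij t.c := by
        apply Units.ext; rw [hg, tv_coe]; rfl
      rw [this, htv]
    · intro A B hA hB iA iB g hg
      have : g = GeneralLinearGroup.mkOfDetNeZero A hA * GeneralLinearGroup.mkOfDetNeZero B hB := by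
        apply Units.ext; rw [hg]; rfl
      rw [this, hf.c, iA _ rfl, iB _ rfl]; simp
  funext g
  exact key g.val (g.isUnit.map Matrix.detMonoidHom).ne_zero g rfl

end coc2

section coc3
variable {K : Type} [Field K] {n : ℕ} {f : GL (Fin n) K → CC K n}

def flip (v : CC K n) : CC K n := fun p q => v p.swap q.swap

lemma flip_act (g : GL (Fin n) K) (v : CC K n) : act g (flip v) = flip (act g v) := by
  ext ⟨a, c⟩ ⟨b, d⟩
  simp only [act_def, flip, kr, Matrix.mul_apply, Fintype.sum_prod_type, Matrix.kroneckerMap_apply,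
    Prod.swap_prod_mk, Prod.fst_swap, Prod.snd_swap]
  rw [Finset.sum_comm]
  refine Finset.sum_congr rfl fun x _ => Finset.sum_congr rfl fun y _ => ?_
  rw [Finset.sum_comm, mul_comm (((g⁻¹ : GL (Fin n) K) : Matrix (Fin n) (Fin n) K) y b)]
  congr 1
  refine Finset.sum_congr rfl fun x _ => Finset.sum_congr rfl fun y _ => ?_
  rw [mul_comm ((g : Matrix (Fin n) (Fin n) K) a y)]

def db (v : CC K n) (g : GL (Fin n) K) : CC K n := act g v - v

lemma db_c (v : CC K n) : IsC (db v) := by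
  intro g h
  simp only [db, act_mul_apply, map_sub]
  abel

lemma IsC.add {f f' : GL (Fin n) K → CC K n} (h : IsC f) (h' : IsC f') : IsC (fun g => f g + f' g) := by
  intro a b
  simp only [h a b, h' a b, map_add]; abel

lemma db_S {v : CC K n} (hv : flip v = v) (g : GL (Fin n) K) (a b c d : Fin n) :
    db v g (a, c) (b, d) = db v g (c, a) (d, b) := by
  have : flip (db v g) = db v g := by
    have h := flip_act g v
    rw [hv] at h
    unfold db
    conv_rhs => rw [h]
    conv_rhs => rw [← hv]
    conv_rhs => rw [flip_act, hv]
    conv_lhs => rw [h]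
    ext ⟨a, c⟩ ⟨b, d⟩
    have := congrFun (congrFun hv (a, c)) (b, d)
    simp only [flip, Matrix.sub_apply, Prod.swap_prod_mk] at this ⊢
    have h2 := congrFun (congrFun h (a, c)) (b, d)
    simp only [flip, Prod.swap_prod_mk] at h2
    rw [this, h2]
  exact congrFun (congrFun this.symm (a, c)) (b, d)

def DD (K : Type) [Field K] (n : ℕ) (s : K) : CC K n := fun p q =>
  if p.1 = p.2 ∧ p.1 = q.1 ∧ p.1 = q.2 then s else 0

lemma DD_S (s : K) : flip (DD K n s) = DD K n s := by
  ext ⟨a, c⟩ ⟨b, d⟩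
  simp only [flip, DD, Prod.swap_prod_mk]
  congr 1
  apply propext
  constructor <;> (rintro ⟨rfl, rfl, rfl⟩; simp)

lemma DD_T (s : K) (t : Fin n → Kˣ) : act (dg t) (DD K n s) = DD K n s := by
  ext ⟨a, c⟩ ⟨b, d⟩
  rw [act_dg]
  simp only [DD]
  split_ifs with h
  · obtain ⟨rfl, rfl, rfl⟩ := h
    simp; field_simp
  · simp

lemma DD_W (s : K) (σ : Equiv.Perm (Fin n)) : act (pm σ) (DD K n s) = DD K n s := by
  ext ⟨a, c⟩ ⟨b, d⟩
  obtain ⟨a, rfl⟩ := σ.surjective a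
  obtain ⟨b, rfl⟩ := σ.surjective b
  obtain ⟨c, rfl⟩ := σ.surjective c
  obtain ⟨d, rfl⟩ := σ.surjective d
  rw [act_pm]
  simp [DD]

lemma exists_perm {i j i' j' : Fin n} (h : i ≠ j) (h' : i' ≠ j') :
    ∃ s : Equiv.Perm (Fin n), s i = i' ∧ s j = j' := by
  refine ⟨Equiv.swap (Equiv.swap i i' j) j' * Equiv.swap i i', ?_, ?_⟩
  · rw [Equiv.Perm.mul_apply, Equiv.swap_apply_left]
    refine Equiv.swap_apply_of_ne_of_ne ?_ h'
    intro h1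
    apply h
    apply (Equiv.swap i i').injective
    rw [Equiv.swap_apply_left, ← h1]
  · rw [Equiv.Perm.mul_apply, Equiv.swap_apply_left]

lemma Good.cob (hf : Good f) (h2 : (2 : K) ≠ 0) (h3 : (3 : K) ≠ 0) (hn : 2 ≤ n) :
    ∃ v, f = db v := by
  have h01 : (⟨0, by omega⟩ : Fin n) ≠ ⟨1, by omega⟩ := by simp
  set α := f (tv h01 1) (⟨0, by omega⟩, ⟨0, by omega⟩) (⟨1, by omega⟩, ⟨0, by omega⟩) with hα
  have hα' : ∀ (i j : Fin n) (h : i ≠ j), f (tv h 1) (i, i) (j, i) = α := by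
    intro i j h
    obtain ⟨s, s1, s2⟩ := exists_perm h01 h
    have := hf.eqv h01 h s s1 s2 1 ⟨0, by omega⟩ ⟨1, by omega⟩ ⟨0, by omega⟩ ⟨0, by omega⟩
    rw [s1, s2] at this
    rw [this]
  have hg : Good (fun g => f g + db (DD K n α) g) := by
    refine ⟨hf.c.add (db_c _), fun t => ?_, fun s => ?_, fun g a b c d => ?_⟩
    · simp [hf.T, db, DD_T]
    · simp [hf.W, db, DD_W]
    · simp only [Matrix.add_apply]
      rw [hf.S, db_S (DD_S _)]
  have hz := hg.zero h2 h3 (by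
    intro i j h
    simp only [Matrix.add_apply, hα', db, Matrix.sub_apply]
    rw [act_tv]
    simp [DD, h, h.symm])
  refine ⟨DD K n (-α), ?_⟩
  funext g
  have := congrFun hz g
  have e : DD K n (-α) = - DD K n α := by
    ext p q; simp only [DD, Matrix.neg_apply]; split_ifs <;> simp
  simp only [Pi.zero_apply] at this
  rw [eq_neg_of_add_eq_zero_left this, e]
  simp [db]; abel

/-- torus vanishing -/
lemma IsC.torus [Fintype K] (hf : IsC f) : ∃ v : CC K n, ∀ t, f (dg t) = db v (dg t) := by
  classical
  set N : K := (Fintype.card (Fin n → Kˣ) : K) with hN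
  have hN0 : N ≠ 0 := by
    rw [hN, Fintype.card_fun, Nat.cast_pow]
    apply pow_ne_zero
    rw [Fintype.card_units, Nat.cast_sub Fintype.card_pos, FiniteField.cast_card_eq_zero]
    simp
  refine ⟨-(N⁻¹ • ∑ t, f (dg t)), fun t => ?_⟩
  have h1 : ∑ s, f (dg (t * s)) = ∑ s, f (dg s) :=
    Fintype.sum_equiv (Equiv.mulLeft t) _ _ (fun s => rfl)
  have h2 : ∑ s, f (dg (t * s)) = N • f (dg t) + act (dg t) (∑ s, f (dg s)) := by
    simp only [map_mul, hf (dg t), Finset.sum_add_distrib, map_sum]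
    congr 1
    rw [Finset.sum_const, Finset.card_univ, hN, Nat.cast_smul_eq_nsmul]
  rw [h1] at h2
  have h3 : f (dg t) = N⁻¹ • (∑ s, f (dg s) - act (dg t) (∑ s, f (dg s))) := by
    rw [sub_eq_of_eq_add h2, smul_smul, inv_mul_cancel₀ hN0, one_smul]
  rw [h3, db, map_neg, map_smul, smul_sub]
  abel

end coc3

section shapiro
variable {K : Type} [Field K] {n : ℕ} {I : Type}

lemma shap_stab (h2 : (2 : K) ≠ 0) (c : Equiv.Perm (Fin n) → (I → Fin n) → K)
    (hc : ∀ s t x, c (s * t) x = c s x + c t (fun i => s⁻¹ (x i))) (x : I → Fin n)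
    (s : Equiv.Perm (Fin n)) (hs : ∀ i, s (x i) = x i) : c s x = 0 := by
  classical
  have c1 : c 1 x = 0 := by simpa using hc 1 1 x
  have key : ∀ t : Equiv.Perm {y // y ∉ Set.range x}, c (Equiv.Perm.ofSubtype t) x = 0 := by
    have fx : ∀ t : Equiv.Perm {y // y ∉ Set.range x}, (fun i => (Equiv.Perm.ofSubtype t)⁻¹ (x i)) = x := by
      intro t; funext i
      rw [← map_inv]
      exact Equiv.Perm.ofSubtype_apply_of_not_mem _ (by simp)
    intro t
    induction t using Equiv.Perm.swap_induction_on with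
    | one => simpa using c1
    | swap_mul t a b hab ih =>
      rw [map_mul, hc, fx, ih, add_zero]
      have := hc (Equiv.Perm.ofSubtype (Equiv.swap a b)) (Equiv.Perm.ofSubtype (Equiv.swap a b)) x
      rw [fx, ← map_mul, Equiv.swap_mul_self, map_one, c1, ← two_mul] at this
      exact (mul_eq_zero.1 this.symm).resolve_left h2
  have h1 : ∀ y, y ∉ Set.range x ↔ s y ∉ Set.range x := by
    intro y
    rw [not_iff_not]
    constructor
    · rintro ⟨i, rfl⟩; exact ⟨i, (hs i).symm⟩
    · rintro ⟨i, hi⟩; refine ⟨i, ?_⟩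
      apply s.injective; rw [hs, hi]
  have h3 : Equiv.Perm.ofSubtype (s.subtypePerm (p := fun y => y ∉ Set.range x) (fun y => (h1 y).symm)) = s := by
    apply Equiv.Perm.ofSubtype_subtypePerm
    rintro y hy ⟨i, rfl⟩
    exact hy (hs i)
  rw [← h3]; exact key _

lemma shap (h2 : (2 : K) ≠ 0) (c : Equiv.Perm (Fin n) → (I → Fin n) → K)
    (hc : ∀ s t x, c (s * t) x = c s x + c t (fun i => s⁻¹ (x i))) :
    ∃ v : (I → Fin n) → K, (∀ s x, c s x = v (fun i => s⁻¹ (x i)) - v x) ∧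
      ∀ x, ∃ s, v x = - c s x := by
  classical
  let r : Setoid (I → Fin n) :=
    { r := fun x y => ∃ s : Equiv.Perm (Fin n), ∀ i, s (x i) = y i
      iseqv := ⟨fun x => ⟨1, fun i => rfl⟩, fun {x y} ⟨s, hs⟩ => ⟨s⁻¹, fun i => by rw [← hs]; simp⟩,
        fun {x y z} ⟨s, hs⟩ ⟨t, ht⟩ => ⟨t * s, fun i => by rw [Equiv.Perm.mul_apply, hs, ht]⟩⟩ }
  let rep : (I → Fin n) → (I → Fin n) := fun x => (Quotient.mk r x).out
  have hrep : ∀ x, ∃ s : Equiv.Perm (Fin n), ∀ i, s (rep x i) = x i := fun x =>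
    Quotient.exact (Quotient.out_eq (Quotient.mk r x))
  choose g hg using hrep
  refine ⟨fun x => - c (g x) x, fun s x => ?_, fun x => ⟨g x, rfl⟩⟩
  set y : I → Fin n := fun i => s⁻¹ (x i) with hy
  have hxy : rep x = rep y := by
    have : Quotient.mk r x = Quotient.mk r y := Quotient.sound ⟨s⁻¹, fun i => rfl⟩
    simp only [rep, this]
  have e1 := hc s (s⁻¹ * g x) x
  rw [mul_inv_cancel_left] at e1
  have e2 := hc (g y) ((g y)⁻¹ * (s⁻¹ * g x)) y
  rw [mul_inv_cancel_left] at e2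
  have e3 : (fun i => (g y)⁻¹ (y i)) = rep y := by
    funext i; rw [← hg y i]; simp
  have e4 := shap_stab h2 c hc (rep y) ((g y)⁻¹ * (s⁻¹ * g x)) (fun i => by
    simp only [Equiv.Perm.mul_apply]
    rw [← hxy, hg x, hxy]
    exact congrFun e3 i)
  rw [e3, e4] at e2
  change c s x = - c (g y) y - - c (g x) x
  rw [e1, e2]; ring

variable {f : GL (Fin n) K → CC K n}

lemma dg_pm (t : Fin n → Kˣ) (s : Equiv.Perm (Fin n)) :
    (dg t : GL (Fin n) K) * pm s = pm s * dg (fun i => t (s i)) := by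
  apply Units.ext
  simp only [Units.val_mul, dg_coe, pm_coe]
  ext a b
  simp only [Matrix.diagonal_mul, Matrix.mul_diagonal, Matrix.of_apply]
  by_cases h : a = s b
  · subst h; simp
  · simp [h]

lemma act_pm' (s : Equiv.Perm (Fin n)) (F : CC K n) (a b c d : Fin n) :
    act (pm s) F (a, c) (b, d) = F (s⁻¹ a, s⁻¹ c) (s⁻¹ b, s⁻¹ d) := by
  rw [← act_pm s F]; simp

lemma db_def (v : CC K n) (g : GL (Fin n) K) : db v g = act g v - v := rfl

lemma IsC.weyl (hf : IsC f) (h2 : (2 : K) ≠ 0) (hT : ∀ t, f (dg t) = 0) :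
    ∃ v : CC K n, (∀ t, db v (dg t) = 0) ∧ ∀ s, f (pm s) = db v (pm s) := by
  have hfix : ∀ t s, act (dg t) (f (pm s)) = f (pm s) := by
    intro t s
    have := congrArg f (dg_pm t s)
    rw [hf, hf, hT, hT] at this
    simpa using this
  obtain ⟨v, hv, hv'⟩ := shap h2 (I := Fin 4) (fun s x => f (pm s) (x 0, x 1) (x 2, x 3)) (by
    intro s t x
    rw [map_mul, hf, Matrix.add_apply, act_pm'])
  refine ⟨Matrix.of fun p q => v ![p.1, p.2, q.1, q.2], fun t => ?_, fun s => ?_⟩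
  · rw [db_def, sub_eq_zero]
    ext ⟨a, c⟩ ⟨b, d⟩
    obtain ⟨s, hs⟩ := hv' ![a, c, b, d]
    have := congrFun (congrFun (hfix t s) (a, c)) (b, d)
    rw [act_dg] at this ⊢
    simp only [Matrix.of_apply, hs]
    simp at this ⊢
    linear_combination this
  · ext ⟨a, c⟩ ⟨b, d⟩
    have := hv s ![a, c, b, d]
    rw [db_def, Matrix.sub_apply, act_pm']
    simp only [Matrix.cons_val] at this
    simp only [Matrix.of_apply]
    rw [this]
    congr 2
    funext i
    fin_cases i <;> rfl

lemma IsC.sub {f f' : GL (Fin n) K → CC K n} (h : IsC f) (h' : IsC f') : IsC (fun g => f g - f' g) := by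
  intro a b
  simp only [h a b, h' a b, map_sub, map_add]; abel

lemma flip_add (v w : CC K n) : flip (v + w) = flip v + flip w := rfl
lemma flip_sub (v w : CC K n) : flip (v - w) = flip v - flip w := rfl
lemma flip_flip (v : CC K n) : flip (flip v) = v := rfl

lemma IsC.flip (h : IsC f) : IsC (fun g => flip (f g)) := by
  intro a b
  simp only [h a b, flip_add, flip_act]

lemma db_flip (v : CC K n) (g) : GLSym.flip (db v g) = db (GLSym.flip v) g := by
  rw [db, db, flip_sub, flip_act]

lemma db_add (v w : CC K n) (g) : db (v + w) g = db v g + db w g := by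
  simp only [db, map_add]; abel

theorem IsC.main [Fintype K] (hf : IsC f) (h2 : (2 : K) ≠ 0) (h3 : (3 : K) ≠ 0) (hn : 2 ≤ n) :
    ∃ v : CC K n, ∀ g, f g + GLSym.flip (f g) = db v g := by
  obtain ⟨v1, h1⟩ := hf.torus
  have hf1 := hf.sub (db_c v1)
  obtain ⟨v2, h4, h5⟩ := hf1.weyl h2 (fun t => by simp only [h1, sub_self])
  have hf2 := hf1.sub (db_c v2)
  have hg : Good (fun g => (f g - db v1 g - db v2 g) + GLSym.flip (f g - db v1 g - db v2 g)) := by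
    refine ⟨hf2.add hf2.flip, fun t => ?_, fun s => ?_, fun g a b c d => ?_⟩
    · simp only [h1, h4, sub_self]; ext; simp [GLSym.flip]
    · simp only [h5, sub_self]; ext; simp [GLSym.flip]
    · simp only [Matrix.add_apply, GLSym.flip, Prod.swap_prod_mk]; ring
  obtain ⟨v, hv⟩ := hg.cob h2 h3 hn
  refine ⟨v + v1 + v2 + GLSym.flip v1 + GLSym.flip v2, fun g => ?_⟩
  have := congrFun hv g
  simp only [flip_sub, db_flip] at this
  simp only [db_add, ← this]
  abel

end shapiro

section sym
variable {K : Type} [Field K] {n : ℕ}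

abbrev S2 (K : Type) [Field K] (n : ℕ) := SymPow K (Matrix (Fin n) (Fin n) K) 2

def sr (K : Type) [Field K] (n : ℕ) : Representation K (GL (Fin n) K) (S2 K n) :=
  symPowRep K (Matrix (Fin n) (Fin n) K) 2 (glConj K n)

def mk2 (A B : Matrix (Fin n) (Fin n) K) : S2 K n :=
  Submodule.Quotient.mk (PiTensorProduct.tprod K ![A, B])

lemma mk2_comm (A B : Matrix (Fin n) (Fin n) K) : mk2 A B = mk2 B A := by
  unfold mk2
  rw [Submodule.Quotient.eq]
  refine Submodule.subset_span ⟨Equiv.swap 0 1, ![A, B], ?_⟩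
  congr 2
  funext i; fin_cases i <;> rfl

lemma mk2_act (g : GL (Fin n) K) (A B : Matrix (Fin n) (Fin n) K) :
    sr K n g (mk2 A B) = mk2 (glConj K n g A) (glConj K n g B) := by
  unfold sr mk2
  refine (congrArg Submodule.Quotient.mk (tpowRep_apply K _ 2 (glConj K n) g ![A, B])).trans ?_
  congr 2
  funext i; fin_cases i <;> rfl

def phi0 : MultilinearMap K (fun _ : Fin 2 => Matrix (Fin n) (Fin n) K) (CC K n) where
  toFun x := x 0 ⊗ₖ x 1 + x 1 ⊗ₖ x 0
  map_update_add' := by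
    intro _ m i x y
    fin_cases i <;>
    simp [Matrix.add_kronecker, Matrix.kronecker_add] <;> abel
  map_update_smul' := by
    intro _ m i c x
    fin_cases i <;>
    simp [Matrix.smul_kronecker, Matrix.kronecker_smul]

def phi : S2 K n →ₗ[K] CC K n :=
  Submodule.liftQ _ (PiTensorProduct.lift phi0) (by
    rw [symPowSub, Submodule.span_le]
    rintro z ⟨σ, x, rfl⟩
    simp only [SetLike.mem_coe, LinearMap.mem_ker, map_sub, PiTensorProduct.lift.tprod]
    have h : ∀ σ : Equiv.Perm (Fin 2), σ = 1 ∨ σ = Equiv.swap 0 1 := by decide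
    rcases h σ with rfl | rfl
    · simp
    · simp [phi0]; abel)

lemma phi_mk2 (A B : Matrix (Fin n) (Fin n) K) : phi (mk2 A B) = A ⊗ₖ B + B ⊗ₖ A := by
  unfold phi mk2
  rw [Submodule.liftQ_apply, PiTensorProduct.lift.tprod]
  rfl

lemma s2_ext {M : Type} [AddCommGroup M] [Module K M] {F F' : S2 K n →ₗ[K] M}
    (h : ∀ A B, F (mk2 A B) = F' (mk2 A B)) : F = F' := by
  refine Submodule.linearMap_qext _ (PiTensorProduct.ext ?_)
  refine MultilinearMap.ext fun x => ?_
  have := h (x 0) (x 1)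
  have e : ![x 0, x 1] = x := by funext i; fin_cases i <;> rfl
  simp only [mk2, e] at this
  exact this

lemma s2_ext' {M : Type} [AddCommGroup M] [Module K M] {F F' : S2 K n →ₗ[K] M}
    (h : ∀ a b c d, F (mk2 (Matrix.single a b 1) (Matrix.single c d 1)) =
      F' (mk2 (Matrix.single a b 1) (Matrix.single c d 1))) : F = F' := by
  refine Submodule.linearMap_qext _ (PiTensorProduct.ext ?_)
  refine Module.Basis.ext_multilinear (fun _ => Matrix.stdBasis K (Fin n) (Fin n)) ?_
  intro v
  have := h (v 0).1 (v 0).2 (v 1).1 (v 1).2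
  have e : ![(Matrix.single (v 0).1 (v 0).2 1 : Matrix (Fin n) (Fin n) K), Matrix.single (v 1).1 (v 1).2 1] =
      fun i => Matrix.stdBasis K (Fin n) (Fin n) (v i) := by
    funext i; 
    fin_cases i <;> exact (Matrix.stdBasis_eq_single K _ _).symm
  simp only [mk2, e] at this
  simpa using this

def psi : CC K n →ₗ[K] S2 K n :=
  ∑ p : Fin n × Fin n, ∑ q : Fin n × Fin n,
    (LinearMap.proj q ∘ₗ LinearMap.proj p ∘ₗ (Matrix.ofLinearEquiv K).symm.toLinearMap : CC K n →ₗ[K] K).smulRight (mk2 (Matrix.single p.1 q.1 (1:K)) (Matrix.single p.2 q.2 1))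

lemma psi_apply (v : CC K n) : psi v = ∑ p : Fin n × Fin n, ∑ q : Fin n × Fin n, v p q •
    (mk2 (Matrix.single p.1 q.1 (1:K)) (Matrix.single p.2 q.2 1)) := by
  simp [psi]

lemma psi_single (p q : Fin n × Fin n) : psi (Matrix.single p q (1:K)) = 
    mk2 (Matrix.single p.1 q.1 (1:K)) (Matrix.single p.2 q.2 1) := by
  rw [psi_apply]
  rw [Finset.sum_eq_single p, Finset.sum_eq_single q]
  · simp
  · intro q' _ h; rw [Matrix.single_apply_of_ne]; simp; simp [h.symm]
  · simp
  · intro p' _ h; apply Finset.sum_eq_zero; intro q' _; rw [Matrix.single_apply_of_ne]; simp; simp [h.symm]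
  · simp

lemma kron_single (a b c d : Fin n) : (Matrix.single a b (1:K)) ⊗ₖ (Matrix.single c d (1:K)) =
   Matrix.single (a, c) (b, d) 1 := by
  rw [Matrix.single_kronecker_single, mul_one]

lemma psi_phi (z : S2 K n) : psi (phi z) = (2 : K) • z := by
  have : psi ∘ₗ phi = (2 : K) • (LinearMap.id : S2 K n →ₗ[K] S2 K n) := by
    apply s2_ext'
    intro a b c d
    simp only [LinearMap.comp_apply, phi_mk2, kron_single, map_add, psi_single, LinearMap.smul_apply, LinearMap.id_apply]
    rw [mk2_comm (Matrix.single c d 1), two_smul]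
  exact LinearMap.congr_fun this z

lemma phi_psi (v : CC K n) : phi (psi v) = v + flip v := by
  rw [psi_apply]
  simp only [map_sum, map_smul, phi_mk2, kron_single, smul_add, Finset.sum_add_distrib]
  ext ⟨a, c⟩ ⟨b, d⟩
  simp only [Matrix.add_apply, Matrix.sum_apply, Matrix.smul_apply, flip]
  congr 1
  · rw [Finset.sum_eq_single (a, c), Finset.sum_eq_single (b, d)]
    · simp
    · rintro ⟨b', d'⟩ _ h; rw [Matrix.single_apply_of_ne]; simp; rintro ⟨-, h'⟩; exact h h'
    · simp
    · rintro ⟨b', d'⟩ _ h; apply Finset.sum_eq_zero; rintro q' _; rw [Matrix.single_apply_of_ne]; simp; rintro ⟨h', -⟩; exact h h'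
    · simp
  · rw [Finset.sum_eq_single (c, a), Finset.sum_eq_single (d, b)]
    · simp
    · rintro ⟨b', d'⟩ _ h; rw [Matrix.single_apply_of_ne]; simp; rintro ⟨-, h'⟩; apply h; simp at h'; simp [h']
    · simp
    · rintro ⟨b', d'⟩ _ h; apply Finset.sum_eq_zero; rintro q' _; rw [Matrix.single_apply_of_ne]; simp; rintro ⟨h', -⟩; apply h; simp at h'; simp [h']
    · simp

lemma phi_act (g : GL (Fin n) K) (z : S2 K n) : phi (sr K n g z) = act g (phi z) := by
  have : phi ∘ₗ (sr K n g) = (act g : CC K n →ₗ[K] CC K n) ∘ₗ phi := by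
    apply s2_ext
    intro A B
    simp only [LinearMap.comp_apply, mk2_act, phi_mk2, map_add, act_def, kr]
    simp only [← Matrix.mul_kronecker_mul]
    rfl
  exact LinearMap.congr_fun this z

lemma phi_inj (h2 : (2 : K) ≠ 0) {z w : S2 K n} (h : phi z = phi w) : z = w := by
  have := congrArg psi h
  rw [psi_phi, psi_phi] at this
  exact smul_right_injective _ h2 this

lemma phi_flip (h2 : (2 : K) ≠ 0) (z : S2 K n) : flip (phi z) = phi z := by
  have := phi_psi (phi z)
  rw [psi_phi, map_smul, two_smul] at this
  exact (add_left_cancel this).symm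

lemma psi_act (h2 : (2 : K) ≠ 0) (g : GL (Fin n) K) (v : CC K n) : psi (act g v) = sr K n g (psi v) := by
  apply phi_inj h2
  rw [phi_psi, phi_act, phi_psi, map_add, flip_act]

theorem s2_cob [Fintype K] (h2 : (2 : K) ≠ 0) (h3 : (3 : K) ≠ 0) (hn : 2 ≤ n)
    (f : GL (Fin n) K → S2 K n) (hf : ∀ g h, f (g * h) = f g + sr K n g (f h)) :
    ∃ w, ∀ g, f g = sr K n g w - w := by
  have hc : IsC (fun g => phi (f g)) := by
    intro g h
    simp only [hf g h, map_add, phi_act]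
  obtain ⟨v, hv⟩ := hc.main h2 h3 hn
  refine ⟨(4 : K)⁻¹ • psi v, fun g => ?_⟩
  have h4 : (4 : K) ≠ 0 := by
    have : (4 : K) = 2 * 2 := by norm_num
    rw [this]; exact mul_ne_zero h2 h2
  have := congrArg psi (hv g)
  rw [phi_flip h2, map_add, psi_phi, db_def, map_sub, psi_act h2, ← add_smul] at this
  rw [map_smul, ← smul_sub, ← this, smul_smul]
  have e : (4 : K)⁻¹ * (2 + 2) = 1 := by
    rw [show (2 + 2 : K) = 4 by norm_num]; exact inv_mul_cancel₀ h4
  rw [e, one_smul]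

end sym

section inv
variable {K : Type} [Field K] {n : ℕ}

def PP (K : Type) [Field K] (n : ℕ) : CC K n := Matrix.of fun p q => if p.1 = q.2 ∧ p.2 = q.1 then 1 else 0

lemma act_one' (g : GL (Fin n) K) : act g (1 : CC K n) = 1 := by
  rw [act_def, mul_one, ← kr_mul, mul_inv_cancel, kr_one]

lemma act_PP (g : GL (Fin n) K) : act g (PP K n) = PP K n := by
  have : kr g * PP K n = PP K n * kr g := by
    ext ⟨a, c⟩ ⟨b, d⟩
    simp only [kr, PP, Matrix.mul_apply, Fintype.sum_prod_type, Matrix.kroneckerMap_apply, Matrix.of_apply, ite_and]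
    simp [mul_comm]
  rw [act_def, this, Matrix.mul_assoc, ← kr_mul, mul_inv_cancel, kr_one, mul_one]

lemma flip_PP : flip (PP K n) = PP K n := by
  ext ⟨a, c⟩ ⟨b, d⟩
  simp [flip, PP, and_comm]

lemma flip_one : flip (1 : CC K n) = 1 := by
  ext ⟨a, c⟩ ⟨b, d⟩
  simp [flip, Matrix.one_apply, and_comm]

lemma inv_form (h2 : (2 : K) ≠ 0) (h3 : (3 : K) ≠ 0) (hn : 2 ≤ n) {X : CC K n}
    (hX : ∀ g, act g X = X) : ∃ u v : K, X = u • 1 + v • PP K n := by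
  have h01 : (⟨0, by omega⟩ : Fin n) ≠ ⟨1, by omega⟩ := by simp
  generalize (⟨0, by omega⟩ : Fin n) = i at h01
  generalize (⟨1, by omega⟩ : Fin n) = j at h01
  have hT : ∀ l a b c d, wt l a b c d ≠ 0 → X (a, c) (b, d) = 0 := fun l a b c d =>
    van_gen h2 h3 l (hX _).symm a b c d
  have hW : ∀ (s : Equiv.Perm (Fin n)) a b c d, X (s a, s c) (s b, s d) = X (a, c) (b, d) := by
    intro s a b c d
    conv_lhs => rw [← hX (pm s)]
    rw [act_pm]
  have hu : ∀ a b, a ≠ b → X (a, b) (a, b) = X (i, j) (i, j) := by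
    intro a b h
    obtain ⟨s, rfl, rfl⟩ := exists_perm h01 h
    rw [hW]
  have hv : ∀ a b, a ≠ b → X (a, b) (b, a) = X (i, j) (j, i) := by
    intro a b h
    obtain ⟨s, rfl, rfl⟩ := exists_perm h01 h
    rw [hW]
  have hz : ∀ a, X (a, a) (a, a) = X (i, j) (i, j) + X (i, j) (j, i) := by
    intro a
    have h1 : X (a, a) (a, a) = X (i, i) (i, i) := by
      rw [← hW (Equiv.swap i a) i i i i, Equiv.swap_apply_left]
    have h5 := congrFun (congrFun (hX (tv h01 1)) (i, i)) (j, i)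
    rw [act_tv] at h5
    simp only [h01, h01.symm, if_true, if_false, one_mul, mul_one, zero_mul, add_zero, sub_zero] at h5
    rw [hT i j j j i (by simp [wt, h01, h01.symm]), hT i j i i i (by simp [wt, h01, h01.symm]),
      hT i i i j i (by simp [wt, h01, h01.symm]), hT i j i j i (by simp [wt, h01, h01.symm]),
      hu _ _ h01.symm] at h5
    rw [h1]
    linear_combination -h5
  refine ⟨X (i, j) (i, j), X (i, j) (j, i), ?_⟩
  ext ⟨a, c⟩ ⟨b, d⟩
  simp only [Matrix.add_apply, Matrix.smul_apply, Matrix.one_apply, PP, Matrix.of_apply, Prod.mk.injEq, smul_eq_mul]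
  by_cases h1 : a = b
  · subst h1
    by_cases h4 : c = d
    · subst h4
      by_cases h5 : a = c
      · subst h5; simp [hz]
      · simp [h5, hu _ _ h5]
    · rw [hT c a a c d (by simp [wt, Ne.symm h4])]
      have : ¬ (a = d ∧ c = a) := by rintro ⟨rfl, rfl⟩; exact h4 rfl
      simp [h4, this]
  · by_cases h4 : a = d
    · subst h4
      by_cases h5 : c = b
      · subst h5
        simp [h1, hv _ _ h1]
      · rw [hT c a b c a (by simp [wt, Ne.symm h5])]
        simp [h1, h5]
    · rw [hT a a b c d (by simp [wt, Ne.symm h1, Ne.symm h4]; split_ifs <;> omega)]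
      simp [h1, h4]

lemma finrank_inv (h2 : (2 : K) ≠ 0) (h3 : (3 : K) ≠ 0) (hn : 2 ≤ n) :
    Module.finrank K (sr K n).invariants = 2 := by
  have hsp : (sr K n).invariants = Submodule.span K (Set.range ![psi (1 : CC K n), psi (PP K n)]) := by
    apply le_antisymm
    · intro z hz
      rw [Representation.mem_invariants] at hz
      obtain ⟨u, v, huv⟩ := inv_form h2 h3 hn (X := phi z) (fun g => by rw [← phi_act, hz])
      have := congrArg psi huv
      rw [psi_phi, map_add, map_smul, map_smul] at this
      have hz2 : z = (2 : K)⁻¹ • (u • psi 1 + v • psi (PP K n)) := by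
        rw [← this, smul_smul, inv_mul_cancel₀ h2, one_smul]
      rw [hz2]
      apply Submodule.smul_mem
      apply Submodule.add_mem <;> apply Submodule.smul_mem <;> apply Submodule.subset_span
      · exact ⟨0, rfl⟩
      · exact ⟨1, rfl⟩
    · rw [Submodule.span_le]
      rintro _ ⟨i, rfl⟩
      fin_cases i
      · simp only [SetLike.mem_coe, Representation.mem_invariants]
        intro g
        simp [← psi_act h2, act_one']
      · simp only [SetLike.mem_coe, Representation.mem_invariants]
        intro g
        simp [← psi_act h2, act_PP]
  have hli : LinearIndependent K ![psi (1 : CC K n), psi (PP K n)] := by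
    rw [LinearIndependent.pair_iff]
    intro s t h
    have h1 := congrArg phi h
    rw [map_add, map_smul, map_smul, phi_psi, phi_psi, flip_PP, flip_one, map_zero] at h1
    have e1 := congrFun (congrFun h1 (⟨0, by omega⟩, ⟨1, by omega⟩)) (⟨0, by omega⟩, ⟨1, by omega⟩)
    have e2 := congrFun (congrFun h1 (⟨0, by omega⟩, ⟨1, by omega⟩)) (⟨1, by omega⟩, ⟨0, by omega⟩)
    simp [PP, Matrix.one_apply] at e1 e2
    rw [← two_mul] at e1 e2
    exact ⟨(mul_eq_zero.1 e1).resolve_left h2, (mul_eq_zero.1 e2).resolve_left h2⟩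
  rw [hsp, finrank_span_eq_card hli]
  rfl

end inv

theorem final (k : Type) [Field k] [Fintype k] (p : ℕ) [CharP k p] (hp : 5 ≤ p)
    (n : ℕ) (hn : 2 ≤ n) :
    Module.finrank k (groupCohomology (Rep.of (symPowRep k (Matrix (Fin n) (Fin n) k) 2 (glConj k n))) 0) = 2 ∧
    Subsingleton (groupCohomology (Rep.of (symPowRep k (Matrix (Fin n) (Fin n) k) 2 (glConj k n))) 1) := by
  have h2 : (2 : k) ≠ 0 := by
    intro h
    have := (CharP.cast_eq_zero_iff k p 2).1 (by exact_mod_cast h)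
    have := Nat.le_of_dvd (by norm_num) this
    omega
  have h3 : (3 : k) ≠ 0 := by
    intro h
    have := (CharP.cast_eq_zero_iff k p 3).1 (by exact_mod_cast h)
    have := Nat.le_of_dvd (by norm_num) this
    omega
  constructor
  · rw [LinearEquiv.finrank_eq (groupCohomology.H0Iso
      (Rep.of (symPowRep k (Matrix (Fin n) (Fin n) k) 2 (glConj k n)))).toLinearEquiv]
    exact finrank_inv h2 h3 hn
  · refine subsingleton_of_forall_eq 0 fun x => ?_
    induction x using groupCohomology.H1_induction_on with
    | h x =>
      rw [groupCohomology.H1π_eq_zero_iff]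
      obtain ⟨w, hw⟩ := s2_cob h2 h3 hn (fun g => x g) (fun g h => by
        have := (groupCohomology.mem_cocycles₁_iff x).1 x.2 g h
        refine this.trans ?_
        rw [add_comm]; rfl)
      exact ⟨w, funext fun g => (hw g).symm⟩

end GLSym

/-- Low-degree cohomology of `GL(n,k)` with coefficients in `S²(gl_n)`,
for `k` finite of characteristic `p ≥ 5` and `n ≥ 2`. -/
theorem gl_cohomology_sym2_low_degrees
    (k : Type) [Field k] [Fintype k] (p : ℕ) [CharP k p] (hp : 5 ≤ p)
    (n : ℕ) (hn : 2 ≤ n) :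
    Module.finrank k (groupCohomology (Rep.of (symPowRep k (Matrix (Fin n) (Fin n) k) 2 (glConj k n))) 0) = 2 ∧
    Subsingleton (groupCohomology (Rep.of (symPowRep k (Matrix (Fin n) (Fin n) k) 2 (glConj k n))) 1) := by
  exact GLSym.final k p hp n hn
end
end

section
/- Let k be a field of characteristic 2 and let A, B be finite-dimensional k-vector spaces. Let α: Λ²A ⊗ Λ²B → S²(A⊗B) be the k-linear map determined by α((a∧a')⊗(b∧b')) = (a⊗b)·(a'⊗b') + (a⊗b')·(a'⊗b), and let β: S²(A⊗B) → S²A ⊗ S²B be the k-linear map determined by β((a⊗b)·(a'⊗b')) = (a·a')⊗(b·b'). Then the sequence 0 → Λ²A ⊗ Λ²B → S²(A⊗B) → S²A ⊗ S²B → 0 is exact: α is injective, the kernel of β equals the image of α, and β is surjective. -/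
open scoped TensorProduct

noncomputable section

variable (k : Type) [Field k] (V : Type) [AddCommGroup V] [Module k V]

/-- The subspace of `V ⊗ V` by which one quotients to obtain the second symmetric power. -/
def sym2Sub : Submodule k (V ⊗[k] V) :=
  Submodule.span k {z | ∃ x y : V, z = x ⊗ₜ[k] y - y ⊗ₜ[k] x}

/-- The second symmetric power `S²V = (V⊗V)/⟨x⊗y − y⊗x⟩`. -/
abbrev Sym2Pow := (V ⊗[k] V) ⧸ sym2Sub k V

/-- The product `x·y`, i.e. the image of `x ⊗ y` in `S²V`. -/
def symMk (x y : V) : Sym2Pow k V := Submodule.Quotient.mk (x ⊗ₜ[k] y)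

/-- The subspace of `V ⊗ V` by which one quotients to obtain the second exterior power. -/
def ext2Sub : Submodule k (V ⊗[k] V) :=
  Submodule.span k {z | ∃ x : V, z = x ⊗ₜ[k] x}

/-- The second exterior power `Λ²V = (V⊗V)/⟨x⊗x⟩`. -/
abbrev Ext2Pow := (V ⊗[k] V) ⧸ ext2Sub k V

/-- The wedge `x∧y`, i.e. the image of `x ⊗ y` in `Λ²V`. -/
def wedgeMk (x y : V) : Ext2Pow k V := Submodule.Quotient.mk (x ⊗ₜ[k] y)

theorem symMk_comm' (x y : V) : symMk k V x y = symMk k V y x := by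
  unfold symMk
  rw [Submodule.Quotient.eq]
  exact Submodule.subset_span ⟨x, y, rfl⟩

theorem wedge_split [CharP k 2] :
    ∃ t : V ⊗[k] V →ₗ[k] Ext2Pow k V,
      ∀ x y, t (x ⊗ₜ y) + t (y ⊗ₜ x) = wedgeMk k V x y := by
  classical
  let b := Module.Basis.ofVectorSpace k V
  letI : LinearOrder (Module.Basis.ofVectorSpaceIndex k V) := linearOrderOfSTO WellOrderingRel
  have hself : ∀ x : V, wedgeMk k V x x = 0 := fun x => by
    unfold wedgeMk
    rw [Submodule.Quotient.mk_eq_zero]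
    exact Submodule.subset_span ⟨x, rfl⟩
  have hadd1 : ∀ x y z : V, wedgeMk k V (x + y) z = wedgeMk k V x z + wedgeMk k V y z :=
    fun x y z => by simp [wedgeMk, TensorProduct.add_tmul]
  have hadd2 : ∀ x y z : V, wedgeMk k V z (x + y) = wedgeMk k V z x + wedgeMk k V z y :=
    fun x y z => by simp [wedgeMk, TensorProduct.tmul_add]
  have h2 : ∀ z : Ext2Pow k V, z + z = 0 := fun z => by
    rw [← two_smul k z, CharTwo.two_eq_zero, zero_smul]
  have hcomm : ∀ x y : V, wedgeMk k V x y = wedgeMk k V y x := fun x y => by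
    have h := hself (x + y)
    rw [hadd1, hadd2, hadd2, hself, hself, zero_add, add_zero] at h
    have h3 := h2 (wedgeMk k V y x)
    exact add_right_cancel (h.trans h3.symm)
  let t : V ⊗[k] V →ₗ[k] Ext2Pow k V := (b.tensorProduct b).constr k
    (fun p => if p.1 < p.2 then wedgeMk k V (b p.1) (b p.2) else 0)
  have ht : ∀ i j, t (b i ⊗ₜ b j) = if i < j then wedgeMk k V (b i) (b j) else 0 := fun i j => by
    have := (b.tensorProduct b).constr_basis k
      (fun p => if p.1 < p.2 then wedgeMk k V (b p.1) (b p.2) else 0) (i, j)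
    simpa [Module.Basis.tensorProduct_apply] using this
  refine ⟨t, fun x y => ?_⟩
  have key : t + t ∘ₗ (TensorProduct.comm k V V).toLinearMap = (ext2Sub k V).mkQ := by
    apply (b.tensorProduct b).ext
    rintro ⟨i, j⟩
    have : (ext2Sub k V).mkQ (b i ⊗ₜ b j) = wedgeMk k V (b i) (b j) := rfl
    simp only [Module.Basis.tensorProduct_apply, LinearMap.add_apply, LinearMap.comp_apply,
      LinearEquiv.coe_coe, TensorProduct.comm_tmul, ht, this]
    rcases lt_trichotomy i j with h | h | h
    · simp [h, h.le.not_gt]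
    · subst h; simp [hself]
    · simp [h, h.le.not_gt, hcomm (b i) (b j)]
  exact LinearMap.congr_fun key (x ⊗ₜ y)

theorem sym_lift (W : Type) [AddCommGroup W] [Module k W] (f : V ⊗[k] V →ₗ[k] W)
    (hf : ∀ x y, f (x ⊗ₜ y) = f (y ⊗ₜ x)) :
    ∃ F : Sym2Pow k V →ₗ[k] W, ∀ x y, F (symMk k V x y) = f (x ⊗ₜ y) := by
  refine ⟨(sym2Sub k V).liftQ f ?_, fun x y => rfl⟩
  unfold sym2Sub
  rw [Submodule.span_le]
  rintro _ ⟨x, y, rfl⟩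
  simp [hf x y]

/-- In characteristic 2, the Akin–Buchsbaum–Weyman sequence
`0 → Λ²A ⊗ Λ²B → S²(A⊗B) → S²A ⊗ S²B → 0` is exact. -/
theorem abw_sequence_exact_char_two
    (k : Type) [Field k] [CharP k 2]
    (A B : Type) [AddCommGroup A] [Module k A] [FiniteDimensional k A]
    [AddCommGroup B] [Module k B] [FiniteDimensional k B]
    (α : Ext2Pow k A ⊗[k] Ext2Pow k B →ₗ[k] Sym2Pow k (A ⊗[k] B))
    (hα : ∀ (a a' : A) (b b' : B),
      α (wedgeMk k A a a' ⊗ₜ[k] wedgeMk k B b b')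
        = symMk k (A ⊗[k] B) (a ⊗ₜ[k] b) (a' ⊗ₜ[k] b')
          + symMk k (A ⊗[k] B) (a ⊗ₜ[k] b') (a' ⊗ₜ[k] b))
    (β : Sym2Pow k (A ⊗[k] B) →ₗ[k] Sym2Pow k A ⊗[k] Sym2Pow k B)
    (hβ : ∀ (a a' : A) (b b' : B),
      β (symMk k (A ⊗[k] B) (a ⊗ₜ[k] b) (a' ⊗ₜ[k] b'))
        = symMk k A a a' ⊗ₜ[k] symMk k B b b') :
    Function.Injective α ∧
    LinearMap.ker β = LinearMap.range α ∧
    Function.Surjective β := by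
  have h2 : ∀ z : Sym2Pow k (A ⊗[k] B), z + z = 0 := fun z => by
    rw [← two_smul k z, CharTwo.two_eq_zero, zero_smul]
  have h2' : ∀ z : Sym2Pow k A ⊗[k] Sym2Pow k B, z + z = 0 := fun z => by
    rw [← two_smul k z, CharTwo.two_eq_zero, zero_smul]
  let c := TensorProduct.tensorTensorTensorComm k A B A B
  let π : (A ⊗[k] A) ⊗[k] (B ⊗[k] B) →ₗ[k] Sym2Pow k A ⊗[k] Sym2Pow k B :=
    TensorProduct.map (sym2Sub k A).mkQ (sym2Sub k B).mkQ
  let q : (A ⊗[k] B) ⊗[k] (A ⊗[k] B) →ₗ[k] Sym2Pow k (A ⊗[k] B) := (sym2Sub k (A ⊗[k] B)).mkQ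
  have hπ : Function.Surjective π :=
    TensorProduct.map_surjective (Submodule.mkQ_surjective _) (Submodule.mkQ_surjective _)
  have hq : Function.Surjective q := Submodule.mkQ_surjective _
  have hβq : β ∘ₗ q = π ∘ₗ c.toLinearMap := by
    apply TensorProduct.ext_fourfold'
    intro a b a' b'
    exact hβ a a' b b'
  have hβq' : ∀ z, β (q z) = π (c z) := fun z => LinearMap.congr_fun hβq z
  refine ⟨?_, le_antisymm ?_ ?_, ?_⟩
  · obtain ⟨t, ht⟩ := wedge_split k A
    obtain ⟨s, hs⟩ := wedge_split k B
    let g : (A ⊗[k] B) ⊗[k] (A ⊗[k] B) →ₗ[k] Ext2Pow k A ⊗[k] Ext2Pow k B :=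
      TensorProduct.map t s ∘ₗ c.toLinearMap
    have hg : ∀ a b a' b', g ((a ⊗ₜ b) ⊗ₜ (a' ⊗ₜ b')) = t (a ⊗ₜ a') ⊗ₜ s (b ⊗ₜ b') :=
      fun _ _ _ _ => rfl
    obtain ⟨F, hF⟩ := sym_lift k (A ⊗[k] B) _
      (g + g ∘ₗ (TensorProduct.comm k (A ⊗[k] B) (A ⊗[k] B)).toLinearMap)
      (fun x y => by
        simp only [LinearMap.add_apply, LinearMap.comp_apply, LinearEquiv.coe_coe,
          TensorProduct.comm_tmul]
        exact add_comm _ _)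
    have hF' : ∀ x y, F (symMk k (A ⊗[k] B) x y) = g (x ⊗ₜ y) + g (y ⊗ₜ x) := hF
    have hid : ∀ z : (A ⊗[k] A) ⊗[k] (B ⊗[k] B),
        F (α (TensorProduct.map (ext2Sub k A).mkQ (ext2Sub k B).mkQ z)) =
        TensorProduct.map (ext2Sub k A).mkQ (ext2Sub k B).mkQ z := by
      have : F ∘ₗ α ∘ₗ TensorProduct.map (ext2Sub k A).mkQ (ext2Sub k B).mkQ =
          TensorProduct.map (ext2Sub k A).mkQ (ext2Sub k B).mkQ := by
        apply TensorProduct.ext_fourfold'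
        intro a a' b b'
        change F (α (wedgeMk k A a a' ⊗ₜ[k] wedgeMk k B b b')) =
          wedgeMk k A a a' ⊗ₜ[k] wedgeMk k B b b'
        rw [hα, map_add, hF', hF', hg, hg, hg, hg, ← ht, ← hs, TensorProduct.add_tmul,
          TensorProduct.tmul_add, TensorProduct.tmul_add]
        abel
      exact fun z => LinearMap.congr_fun this z
    apply Function.LeftInverse.injective (g := F)
    intro w
    obtain ⟨z, rfl⟩ := TensorProduct.map_surjective (Submodule.mkQ_surjective (ext2Sub k A))
      (Submodule.mkQ_surjective (ext2Sub k B)) w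
    exact hid z
  · let h : (A ⊗[k] A) ⊗[k] (B ⊗[k] B) →ₗ[k] (Sym2Pow k (A ⊗[k] B) ⧸ LinearMap.range α) :=
      (LinearMap.range α).mkQ ∘ₗ q ∘ₗ c.symm.toLinearMap
    have hh : ∀ a a' b b', h ((a ⊗ₜ a') ⊗ₜ (b ⊗ₜ b')) =
      (LinearMap.range α).mkQ (symMk k (A ⊗[k] B) (a ⊗ₜ b) (a' ⊗ₜ b')) := fun _ _ _ _ => rfl
    have hb : ∀ a a' b b', h ((a ⊗ₜ a') ⊗ₜ (b ⊗ₜ b')) = h ((a ⊗ₜ a') ⊗ₜ (b' ⊗ₜ b)) := by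
      intro a a' b b'
      rw [hh, hh, Submodule.mkQ_apply, Submodule.mkQ_apply, Submodule.Quotient.eq]
      refine ⟨wedgeMk k A a a' ⊗ₜ[k] wedgeMk k B b b', ?_⟩
      rw [hα, eq_sub_iff_add_eq, add_assoc, h2, add_zero]
    have ha : ∀ a a' b b', h ((a ⊗ₜ a') ⊗ₜ (b ⊗ₜ b')) = h ((a' ⊗ₜ a) ⊗ₜ (b ⊗ₜ b')) := by
      intro a a' b b'
      rw [hb, hh, hh, symMk_comm']
    have hker : LinearMap.ker π ≤ LinearMap.ker h := by
      have hA : ∀ n ∈ sym2Sub k A, ∀ w, h (n ⊗ₜ w) = 0 := by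
        intro n hn w
        unfold sym2Sub at hn
        induction hn using Submodule.span_induction with
        | mem x hx =>
          obtain ⟨x, y, rfl⟩ := hx
          induction w with
          | zero => simp
          | add u v hu hv => rw [TensorProduct.tmul_add, map_add, hu, hv, add_zero]
          | tmul u v => rw [TensorProduct.sub_tmul, map_sub, ha, sub_self]
        | zero => simp
        | add u v _ _ hu hv => rw [TensorProduct.add_tmul, map_add, hu, hv, add_zero]
        | smul r u _ hu => rw [← TensorProduct.smul_tmul', map_smul, hu, smul_zero]
      have hB : ∀ n ∈ sym2Sub k B, ∀ w, h (w ⊗ₜ n) = 0 := by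
        intro n hn w
        unfold sym2Sub at hn
        induction hn using Submodule.span_induction with
        | mem x hx =>
          obtain ⟨x, y, rfl⟩ := hx
          induction w with
          | zero => simp
          | add u v hu hv => rw [TensorProduct.add_tmul, map_add, hu, hv, add_zero]
          | tmul u v => rw [TensorProduct.tmul_sub, map_sub, hb, sub_self]
        | zero => simp
        | add u v _ _ hu hv => rw [TensorProduct.tmul_add, map_add, hu, hv, add_zero]
        | smul r u _ hu => rw [TensorProduct.tmul_smul, map_smul, hu, smul_zero]
      have e1 : Function.Exact (sym2Sub k A).subtype (sym2Sub k A).mkQ :=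
        LinearMap.exact_subtype_mkQ _
      have e2 : Function.Exact (sym2Sub k B).subtype (sym2Sub k B).mkQ :=
        LinearMap.exact_subtype_mkQ _
      have := TensorProduct.map_ker e1 (Submodule.mkQ_surjective _) e2 (Submodule.mkQ_surjective _)
      change LinearMap.ker (TensorProduct.map _ _) ≤ _
      rw [this, sup_le_iff]
      constructor
      · rintro _ ⟨z, rfl⟩
        rw [LinearMap.mem_ker]
        induction z with
        | zero => simp
        | add u v hu hv => rw [map_add, map_add, hu, hv, add_zero]
        | tmul u v => exact hB _ v.2 u
      · rintro _ ⟨z, rfl⟩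
        rw [LinearMap.mem_ker]
        induction z with
        | zero => simp
        | add u v hu hv => rw [map_add, map_add, hu, hv, add_zero]
        | tmul u v => exact hA _ u.2 v
    intro x hx
    obtain ⟨z, rfl⟩ := hq x
    rw [LinearMap.mem_ker, hβq'] at hx
    have h3 : h (c z) = 0 := hker hx
    change (LinearMap.range α).mkQ (q (c.symm (c z))) = 0 at h3
    rw [LinearEquiv.symm_apply_apply, Submodule.mkQ_apply, Submodule.Quotient.mk_eq_zero] at h3
    exact h3
  · rw [LinearMap.range_le_ker_iff]
    have : (β ∘ₗ α) ∘ₗ TensorProduct.map (ext2Sub k A).mkQ (ext2Sub k B).mkQ = 0 := by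
      apply TensorProduct.ext_fourfold'
      intro a a' b b'
      change β (α (wedgeMk k A a a' ⊗ₜ[k] wedgeMk k B b b')) = 0
      rw [hα, map_add, hβ, hβ, symMk_comm' k B b' b, h2']
    refine LinearMap.ext fun w => ?_
    obtain ⟨z, rfl⟩ := TensorProduct.map_surjective (Submodule.mkQ_surjective (ext2Sub k A))
      (Submodule.mkQ_surjective (ext2Sub k B)) w
    exact LinearMap.congr_fun this z
  · intro y
    obtain ⟨w, rfl⟩ := hπ y
    exact ⟨q (c.symm w), by rw [hβq', LinearEquiv.apply_symm_apply]⟩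
end
end
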